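/- Let A and B be unital semisimple commutative Banach algebras and T : A⁻¹ → B⁻¹ a surjective group homomorphism. Then the following are equivalent: (i) r(Tf − Tg) = r(f − g) for all f, g ∈ A⁻¹; (ii) r(Tf − 1) = r(f − 1) for all f ∈ A⁻¹. Moreover either implies T extends to a real-algebra isomorphism from A onto B. -/

import Mathlib

open WeakDual Filter Topology

namespace S17

set_option linter.unusedSectionVars false

section basics

variable {A : Type*} [NormedCommRing A] [NormedAlgebra ℂ A] [CompleteSpace A]

/-- real-valued spectral radius -/
noncomputable def R (a : A) : ℝ := (spectralRadius ℂ a).toReal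

variable [Nontrivial A]

theorem sr_eq (a : A) : ∃ φ : characterSpace ℂ A, spectralRadius ℂ a = (‖φ a‖₊ : ENNReal) := by
  obtain ⟨z, hz, h⟩ := spectrum.exists_nnnorm_eq_spectralRadius a
  obtain ⟨φ, rfl⟩ := CharacterSpace.mem_spectrum_iff_exists.1 hz
  exact ⟨φ, h.symm⟩

theorem sr_ne_top (a : A) : spectralRadius ℂ a ≠ ⊤ := by
  obtain ⟨φ, h⟩ := sr_eq a
  rw [h]; exact ENNReal.coe_ne_top

theorem sr_R (a : A) : spectralRadius ℂ a = ENNReal.ofReal (R a) :=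
  (ENNReal.ofReal_toReal (sr_ne_top a)).symm

theorem exR (a : A) : ∃ φ : characterSpace ℂ A, ‖φ a‖ = R a := by
  obtain ⟨φ, h⟩ := sr_eq a
  exact ⟨φ, by rw [R, h]; simp⟩

theorem le_R (φ : characterSpace ℂ A) (a : A) : ‖φ a‖ ≤ R a := by
  have h : (‖φ a‖₊ : ENNReal) ≤ spectralRadius ℂ a :=
    le_iSup₂ (f := fun k (_ : k ∈ spectrum ℂ a) => (‖k‖₊ : ENNReal)) (φ a)
      (CharacterSpace.apply_mem_spectrum φ a)
  have := ENNReal.toReal_mono (sr_ne_top a) h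
  simpa [R] using this

theorem R_nonneg (a : A) : 0 ≤ R a := ENNReal.toReal_nonneg

theorem R_le {a : A} {c : ℝ} (h : ∀ φ : characterSpace ℂ A, ‖φ a‖ ≤ c) : R a ≤ c := by
  obtain ⟨φ, hφ⟩ := exR a
  rw [← hφ]; exact h φ

theorem R_lt {a : A} {c : ℝ} (h : ∀ φ : characterSpace ℂ A, ‖φ a‖ < c) : R a < c := by
  obtain ⟨φ, hφ⟩ := exR a
  rw [← hφ]; exact h φ

theorem eq_of_char (hA : ∀ a : A, spectralRadius ℂ a = 0 → a = 0) {a b : A}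
    (h : ∀ φ : characterSpace ℂ A, φ a = φ b) : a = b := by
  rw [← sub_eq_zero]
  apply hA
  obtain ⟨φ, hφ⟩ := sr_eq (a - b)
  rw [hφ, map_sub, h φ]; simp

theorem isUnit_of_char {a : A} (h : ∀ φ : characterSpace ℂ A, φ a ≠ 0) : IsUnit a := by
  by_contra hc
  obtain ⟨φ, hφ⟩ := CharacterSpace.exists_apply_eq_zero hc
  exact h φ hφ

theorem char_unit_ne (φ : characterSpace ℂ A) (u : Aˣ) : φ (u : A) ≠ 0 := by
  intro h
  have : φ ((u : A) * ((u⁻¹ : Aˣ) : A)) = 1 := by simp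
  rw [map_mul, h] at this
  simp at this

theorem char_inv (φ : characterSpace ℂ A) (u : Aˣ) : φ ((u⁻¹ : Aˣ) : A) = (φ (u : A))⁻¹ := by
  have : φ ((u : A) * ((u⁻¹ : Aˣ) : A)) = 1 := by simp
  rw [map_mul] at this
  exact eq_inv_of_mul_eq_one_right this

theorem ex_exists (a : A) : ∃ u : Aˣ, ∀ φ : characterSpace ℂ A, φ (u : A) = Complex.exp (φ a) := by
  let _ : NormedAlgebra ℚ A := NormedAlgebra.restrictScalars ℚ ℂ A
  have h : ∀ φ : characterSpace ℂ A, φ (NormedSpace.exp a) = Complex.exp (φ a) := by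
    intro φ
    rw [NormedSpace.map_exp φ (map_continuous φ), Complex.exp_eq_exp_ℂ]
  have hu : IsUnit (NormedSpace.exp a) := isUnit_of_char fun φ => by
    rw [h]; exact Complex.exp_ne_zero _
  exact ⟨hu.unit, h⟩

/-- exponential as a unit -/
noncomputable def ex (a : A) : Aˣ := Classical.choose (ex_exists a)

theorem char_ex (φ : characterSpace ℂ A) (a : A) : φ (ex a : A) = Complex.exp (φ a) :=
  Classical.choose_spec (ex_exists a) φ

theorem unit_ext (hA : ∀ a : A, spectralRadius ℂ a = 0 → a = 0) {u v : Aˣ}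
    (h : ∀ φ : characterSpace ℂ A, φ (u : A) = φ (v : A)) : u = v :=
  Units.ext (eq_of_char hA h)

theorem ex_add (hA : ∀ a : A, spectralRadius ℂ a = 0 → a = 0) (a b : A) :
    ex (a + b) = ex a * ex b := by
  apply unit_ext hA
  intro φ
  simp [char_ex, Complex.exp_add]

theorem char_algMap (φ : characterSpace ℂ A) (c : ℂ) : φ (algebraMap ℂ A c) = c :=
  AlgHomClass.commutes φ c

theorem summable_log {a : A} (ha : R a < 1) :
    Summable fun n : ℕ => ((-1) ^ (n + 1) / n : ℂ) • a ^ n := by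
  have ht := spectrum.pow_norm_pow_one_div_tendsto_nhds_spectralRadius a
  obtain ⟨ρ, h1, h2⟩ := exists_between ha
  have hρ0 : 0 < ρ := (R_nonneg a).trans_lt h1
  have hlt : spectralRadius ℂ a < ENNReal.ofReal ρ := by
    rw [sr_R]; exact (ENNReal.ofReal_lt_ofReal_iff hρ0).2 h1
  have hev := ht.eventually (gt_mem_nhds hlt)
  apply Summable.of_norm_bounded_eventually_nat (summable_geometric_of_lt_one hρ0.le h2)
  filter_upwards [hev, eventually_ge_atTop 1] with n hn hn1
  have hn' : ‖a ^ n‖ ^ (1 / (n : ℝ)) < ρ := (ENNReal.ofReal_lt_ofReal_iff hρ0).1 hn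
  have hle : ‖a ^ n‖ ≤ ρ ^ n := by
    have := Real.rpow_le_rpow (by positivity) hn'.le (Nat.cast_nonneg n)
    rw [← Real.rpow_mul (norm_nonneg _), one_div, inv_mul_cancel₀ (by positivity), Real.rpow_one,
      Real.rpow_natCast] at this
    exact this
  rw [norm_smul]
  have : ‖((-1) ^ (n + 1) / n : ℂ)‖ ≤ 1 := by
    rw [norm_div, norm_pow]
    simp only [norm_neg, norm_one, one_pow, Complex.norm_natCast]
    rw [div_le_one (by positivity)]
    exact_mod_cast hn1
  calc _ ≤ 1 * ‖a ^ n‖ := by gcongr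
    _ ≤ ρ ^ n := by rw [one_mul]; exact hle

theorem log_exists {a : A} (ha : R a < 1) :
    ∃ l : A, ∀ φ : characterSpace ℂ A, φ l = Complex.log (1 + φ a) := by
  refine ⟨∑' n : ℕ, ((-1) ^ (n + 1) / n : ℂ) • a ^ n, fun φ => ?_⟩
  have h1 := (summable_log ha).hasSum.map φ (map_continuous φ)
  have h2 := Complex.hasSum_taylorSeries_log (z := φ a) ((le_R φ a).trans_lt ha)
  refine h1.unique ?_
  convert h2 using 1
  ext n
  simp [div_mul_eq_mul_div]

end basics

section oneparam

theorem exp1 (g : ℝ → ℂ) (hadd : ∀ s t, g (s + t) = g s * g t) (hc : Continuous g)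
    (h1 : ∀ t, 0 ≤ t → t ≤ 1 → ‖g t - 1‖ < 1) (t : ℝ) :
    g t = Complex.exp (t * Complex.log (g 1)) := by
  have hre : ∀ t, 0 ≤ t → t ≤ 1 → 0 < (g t).re := by
    intro t h0 h2
    have := (Complex.abs_re_le_norm (g t - 1)).trans_lt (h1 t h0 h2)
    rw [abs_lt] at this
    simp at this
    linarith [this.1]
  set z := Complex.log (g 1) with hz
  have hg1 : g 1 ≠ 0 := by
    intro h
    have := hre 1 zero_le_one le_rfl
    rw [h] at this; simp at this
  have him : |z.im| < Real.pi / 2 := by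
    rw [hz, Complex.log_im, Complex.abs_arg_lt_pi_div_two_iff]
    left; exact hre 1 zero_le_one le_rfl
  have hg0 : g 0 = 1 := by
    have := hadd 0 0
    rw [add_zero] at this
    have h0 : g 0 ≠ 0 := by
      intro h
      have := hre 0 le_rfl zero_le_one
      rw [h] at this; simp at this
    exact (mul_eq_left₀ h0).1 this.symm
  let S : AddSubgroup ℝ :=
    { carrier := {t | g t = Complex.exp (t * z)}
      zero_mem' := by simp [hg0]
      add_mem' := by
        intro a b ha hb
        simp only [Set.mem_ofPred_eq] at *
        rw [hadd, ha, hb, ← Complex.exp_add]; push_cast; ring_nf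
      neg_mem' := by
        intro a ha
        simp only [Set.mem_ofPred_eq] at *
        have h := hadd a (-a)
        rw [add_neg_cancel, hg0, ha] at h
        have : g (-a) = (Complex.exp (a * z))⁻¹ := eq_inv_of_mul_eq_one_right h.symm
        rw [this, ← Complex.exp_neg]; push_cast; ring_nf }
  have hmem : ∀ t, t ∈ S ↔ g t = Complex.exp (t * z) := fun t => Iff.rfl
  have hk : ∀ k : ℕ, ((1 / 2 : ℝ) ^ k) ∈ S := by
    intro k
    induction k with
    | zero =>
      rw [hmem]; simp [hz, Complex.exp_log hg1]
    | succ k ih =>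
      rw [hmem] at *
      set s : ℝ := (1 / 2) ^ (k + 1) with hs
      have hs0 : 0 < s := by positivity
      have hs1 : s ≤ 1 := pow_le_one₀ (by norm_num) (by norm_num)
      have h2 : (1 / 2 : ℝ) ^ k = s + s := by rw [hs, pow_succ]; ring
      rw [h2, hadd] at ih
      have h3 : g s ^ 2 = Complex.exp (s * z) ^ 2 := by
        rw [sq, ih, sq, ← Complex.exp_add]; push_cast; ring_nf
      rcases sq_eq_sq_iff_eq_or_eq_neg.1 h3 with h | h
      · exact h
      · exfalso
        have hp := hre s hs0.le hs1
        rw [h, Complex.neg_re, Complex.exp_re] at hp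
        have him2 : (s * z : ℂ).im = s * z.im := by simp
        have hcos : 0 < Real.cos (s * z : ℂ).im := by
          rw [him2]
          apply Real.cos_pos_of_mem_Ioo
          rw [Set.mem_Ioo, ← abs_lt]
          rw [abs_mul, abs_of_pos hs0]
          calc s * |z.im| ≤ 1 * |z.im| := by gcongr
            _ < _ := by rw [one_mul]; exact him
        have := mul_pos (Real.exp_pos (s * z : ℂ).re) hcos
        linarith
  have hdense : Dense (S : Set ℝ) := by
    apply AddSubgroup.dense_of_not_isolated_zero
    intro ε hε
    obtain ⟨k, hk'⟩ := exists_pow_lt_of_lt_one hε (by norm_num : (1 / 2 : ℝ) < 1)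
    exact ⟨_, hk k, by positivity, hk'⟩
  have hclosed : IsClosed (S : Set ℝ) :=
    isClosed_eq hc (by fun_prop)
  have : t ∈ (S : Set ℝ) := by
    rw [← hclosed.closure_eq, hdense.closure_eq]; trivial
  exact this

variable {A : Type*} [NormedCommRing A] [NormedAlgebra ℂ A] [CompleteSpace A] [Nontrivial A]
variable {B : Type*} [NormedCommRing B] [NormedAlgebra ℂ B] [CompleteSpace B] [Nontrivial B]

theorem R_smul (c : ℂ) (a : A) : R (c • a) = ‖c‖ * R a := by
  apply le_antisymm
  · apply R_le
    intro φ
    rw [map_smul, smul_eq_mul, norm_mul]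
    exact mul_le_mul_of_nonneg_left (le_R φ a) (norm_nonneg _)
  · obtain ⟨φ, h⟩ := exR a
    rw [← h, ← norm_mul, ← smul_eq_mul, ← map_smul]
    exact le_R φ _

theorem R_ex_sub_one {a : A} (h : R a ≤ 1) : R ((ex a : A) - 1) ≤ 2 * R a := by
  apply R_le
  intro φ
  rw [map_sub, map_one, char_ex]
  refine (Complex.norm_exp_sub_one_le ((le_R φ a).trans h)).trans ?_
  linarith [le_R φ a]

theorem existsD_small (hA : ∀ a : A, spectralRadius ℂ a = 0 → a = 0)
    (hB : ∀ b : B, spectralRadius ℂ b = 0 → b = 0) (T : Aˣ → Bˣ)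
    (hmul : ∀ f g : Aˣ, T (f * g) = T f * T g)
    (hT : ∀ f : Aˣ, R ((T f : B) - 1) = R ((f : A) - 1)) (a : A) (ha : R a < 1 / 2) :
    ∃ b : B, ∀ t : ℝ, T (ex ((t : ℂ) • a)) = ex ((t : ℂ) • b) := by
  have hbd : ∀ t : ℝ, |t| ≤ 1 → R ((T (ex ((t : ℂ) • a)) : B) - 1) ≤ 2 * (|t| * R a) := by
    intro t ht
    rw [hT]
    have : R ((t : ℂ) • a) = |t| * R a := by rw [R_smul]; simp
    rw [← this]
    apply R_ex_sub_one
    rw [this]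
    nlinarith [R_nonneg a, abs_nonneg t]
  have h1 : R ((T (ex a) : B) - 1) < 1 := by
    have := hbd 1 (by simp)
    simp at this
    linarith
  obtain ⟨b, hb⟩ := log_exists h1
  refine ⟨b, fun t => unit_ext hB fun φ => ?_⟩
  rw [char_ex]
  have key := exp1 (fun t : ℝ => φ (T (ex ((t : ℂ) • a)) : B)) ?_ ?_ ?_ t
  · rw [key, map_smul, hb φ, smul_eq_mul]
    simp
  · intro s t
    rw [← map_mul, ← Units.val_mul, ← hmul, ← ex_add hA]
    push_cast
    rw [add_smul]
  · rw [continuous_iff_continuousAt]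
    intro t
    rw [ContinuousAt, tendsto_iff_norm_sub_tendsto_zero]
    have hlim : Tendsto (fun s : ℝ => ‖φ (T (ex ((t : ℂ) • a)) : B)‖ * (2 * (|s - t| * R a)))
        (𝓝 t) (𝓝 0) := by
      have : Continuous (fun s : ℝ => ‖φ (T (ex ((t : ℂ) • a)) : B)‖ * (2 * (|s - t| * R a))) := by
        fun_prop
      have h := this.tendsto t
      simpa using h
    refine squeeze_zero' (Eventually.of_forall fun _ => norm_nonneg _) ?_ hlim
    filter_upwards [Metric.ball_mem_nhds t zero_lt_one] with s hs
    rw [Metric.mem_ball, Real.dist_eq] at hs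
    have e : φ (T (ex ((s : ℂ) • a)) : B) =
        φ (T (ex ((t : ℂ) • a)) : B) * φ (T (ex (((s - t : ℝ) : ℂ) • a)) : B) := by
      rw [← map_mul, ← Units.val_mul, ← hmul, ← ex_add hA, ← add_smul]
      congr 5
      push_cast; ring_nf
    rw [e]
    have e2 : ∀ x y : ℂ, x * y - x = x * (y - 1) := by intros; ring
    rw [e2, norm_mul]
    gcongr
    refine le_trans ?_ (hbd (s - t) hs.le)
    have := le_R φ ((T (ex (((s - t : ℝ) : ℂ) • a)) : B) - 1)
    rwa [map_sub, map_one] at this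
  · intro s h0 hs1
    have := le_R φ ((T (ex ((s : ℂ) • a)) : B) - 1)
    rw [map_sub, map_one] at this
    refine this.trans_lt ((hbd s (by rw [abs_of_nonneg h0]; exact hs1)).trans_lt ?_)
    rw [abs_of_nonneg h0]
    nlinarith [R_nonneg a]

theorem existsD (hA : ∀ a : A, spectralRadius ℂ a = 0 → a = 0)
    (hB : ∀ b : B, spectralRadius ℂ b = 0 → b = 0) (T : Aˣ → Bˣ)
    (hmul : ∀ f g : Aˣ, T (f * g) = T f * T g)
    (hT : ∀ f : Aˣ, R ((T f : B) - 1) = R ((f : A) - 1)) (a : A) :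
    ∃ b : B, ∀ t : ℝ, T (ex ((t : ℂ) • a)) = ex ((t : ℂ) • b) := by
  set c : ℝ := 2 * R a + 1 with hc
  have hc0 : 0 < c := by have := R_nonneg a; positivity
  obtain ⟨b, hb⟩ := existsD_small hA hB T hmul hT (((c⁻¹ : ℝ) : ℂ) • a) (by
    rw [R_smul, Complex.norm_real, Real.norm_eq_abs, abs_of_pos (inv_pos.2 hc0), inv_mul_lt_iff₀ hc0]
    linarith [R_nonneg a])
  refine ⟨(c : ℂ) • b, fun t => ?_⟩
  have := hb (t * c)
  rw [smul_smul] at this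
  rw [smul_smul]
  convert this using 4
  · push_cast
    rw [mul_assoc, mul_inv_cancel₀ (by exact_mod_cast hc0.ne'), mul_one]
  · push_cast; rfl

/-- Recover the spectral radius from exponentials -/
theorem R_tendsto (b : B) :
    Tendsto (fun n : ℕ => (n : ℝ) * R ((ex ((((n : ℝ)⁻¹ : ℝ) : ℂ) • b) : B) - 1)) atTop (𝓝 (R b)) := by
  rw [tendsto_iff_norm_sub_tendsto_zero]
  have hlim : Tendsto (fun n : ℕ => R b ^ 2 * ((n : ℝ)⁻¹)) atTop (𝓝 0) := by
    simpa using (tendsto_inv_atTop_nhds_zero_nat (𝕜 := ℝ)).const_mul (R b ^ 2)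
  refine squeeze_zero' (Eventually.of_forall fun _ => norm_nonneg _) ?_ hlim
  filter_upwards [eventually_ge_atTop 1, eventually_ge_atTop ⌈R b⌉₊] with n hn1 hn2
  have hn : R b ≤ n := Nat.ceil_le.1 hn2
  have hn0 : (0 : ℝ) < n := by exact_mod_cast hn1
  have hpt : ∀ φ : characterSpace ℂ B,
      ‖φ ((ex ((((n : ℝ)⁻¹ : ℝ) : ℂ) • b) : B) - 1) - (((n : ℝ)⁻¹ : ℝ) : ℂ) * φ b‖
        ≤ R b ^ 2 * ((n : ℝ)⁻¹) ^ 2 := by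
    intro φ
    have hnorm : ‖(((n : ℝ)⁻¹ : ℝ) : ℂ) * φ b‖ ≤ (n : ℝ)⁻¹ * R b := by
      rw [norm_mul, Complex.norm_real, Real.norm_eq_abs, abs_of_pos (inv_pos.2 hn0)]
      gcongr
      exact le_R φ b
    have h := Complex.norm_exp_sub_one_sub_id_le (x := (((n : ℝ)⁻¹ : ℝ) : ℂ) * φ b)
      (hnorm.trans (by rw [inv_mul_le_iff₀ hn0]; linarith))
    rw [map_sub, map_one, char_ex, map_smul, smul_eq_mul]
    refine h.trans ?_
    calc _ ≤ ((n : ℝ)⁻¹ * R b) ^ 2 := by gcongr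
      _ = _ := by ring
  have habs : ∀ φ : characterSpace ℂ B, ‖(((n : ℝ)⁻¹ : ℝ) : ℂ) * φ b‖ = (n : ℝ)⁻¹ * ‖φ b‖ := by
    intro φ
    rw [norm_mul, Complex.norm_real, Real.norm_eq_abs, abs_of_pos (inv_pos.2 hn0)]
  set Y := R ((ex ((((n : ℝ)⁻¹ : ℝ) : ℂ) • b) : B) - 1) with hY
  have u1 : Y ≤ (n : ℝ)⁻¹ * R b + R b ^ 2 * ((n : ℝ)⁻¹) ^ 2 := by
    apply R_le
    intro φ
    have h1 := hpt φ
    have h2 := norm_sub_norm_le (φ ((ex ((((n : ℝ)⁻¹ : ℝ) : ℂ) • b) : B) - 1)) ((((n : ℝ)⁻¹ : ℝ) : ℂ) * φ b)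
    rw [habs] at h2
    have h3 := mul_le_mul_of_nonneg_left (le_R φ b) (inv_pos.2 hn0).le
    linarith
  have u2 : (n : ℝ)⁻¹ * R b ≤ Y + R b ^ 2 * ((n : ℝ)⁻¹) ^ 2 := by
    obtain ⟨φ, hφ⟩ := exR b
    have h1 := hpt φ
    rw [norm_sub_rev] at h1
    have h2 := norm_sub_norm_le ((((n : ℝ)⁻¹ : ℝ) : ℂ) * φ b) (φ ((ex ((((n : ℝ)⁻¹ : ℝ) : ℂ) • b) : B) - 1))
    rw [habs, hφ] at h2
    have h3 := le_R φ ((ex ((((n : ℝ)⁻¹ : ℝ) : ℂ) • b) : B) - 1)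
    linarith
  rw [Real.norm_eq_abs, abs_le]
  have e1 : (n : ℝ) * ((n : ℝ)⁻¹ * R b) = R b := by field_simp
  have e2 : (n : ℝ) * (R b ^ 2 * ((n : ℝ)⁻¹) ^ 2) = R b ^ 2 * (n : ℝ)⁻¹ := by field_simp
  have m1 := mul_le_mul_of_nonneg_left u1 hn0.le
  have m2 := mul_le_mul_of_nonneg_left u2 hn0.le
  rw [mul_add, e1, e2] at m1
  rw [mul_add, e1, e2] at m2
  constructor <;> linarith

theorem ex_inj (hB : ∀ b : B, spectralRadius ℂ b = 0 → b = 0) {b c : B}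
    (h : ∀ t : ℝ, ex ((t : ℂ) • b) = ex ((t : ℂ) • c)) : b = c := by
  rw [← sub_eq_zero]
  apply hB
  have h2 : ∀ t : ℝ, ex ((t : ℂ) • (b - c)) = 1 := by
    intro t
    rw [smul_sub, sub_eq_add_neg, ex_add hB, h t, ← ex_add hB, add_neg_cancel]
    exact unit_ext hB fun φ => by simp [char_ex]
  have h3 := R_tendsto (b - c)
  have h4 : (fun n : ℕ => (n : ℝ) * R ((ex ((((n : ℝ)⁻¹ : ℝ) : ℂ) • (b - c)) : B) - 1)) = fun _ => 0 := by
    ext n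
    rw [h2]
    have : R (0 : B) = 0 := le_antisymm (R_le fun φ => by simp) (R_nonneg _)
    simp [this]
  rw [h4] at h3
  rw [sr_R, tendsto_nhds_unique h3 tendsto_const_nhds]
  simp

end oneparam

section dmap

variable {A : Type*} [NormedCommRing A] [NormedAlgebra ℂ A] [CompleteSpace A] [Nontrivial A]
variable {B : Type*} [NormedCommRing B] [NormedAlgebra ℂ B] [CompleteSpace B] [Nontrivial B]

theorem exD (hA : ∀ a : A, spectralRadius ℂ a = 0 → a = 0)
    (hB : ∀ b : B, spectralRadius ℂ b = 0 → b = 0) (T : Aˣ ≃* Bˣ)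
    (hT : ∀ f : Aˣ, R ((T f : B) - 1) = R ((f : A) - 1)) :
    ∃ D : A ≃+ B, (∀ a, T (ex a) = ex (D a)) ∧
      (∀ (t : ℝ) (a : A), D ((t : ℂ) • a) = (t : ℂ) • D a) ∧ (∀ a, R (D a) = R a) := by
  have hT2 : ∀ f : Bˣ, R ((T.symm f : A) - 1) = R ((f : B) - 1) := by
    intro f
    have := hT (T.symm f)
    rw [T.apply_symm_apply] at this
    exact this.symm
  choose D hD using existsD hA hB T (map_mul T) hT
  choose E hE using existsD hB hA T.symm (map_mul T.symm) hT2
  have hDE : ∀ b, D (E b) = b := by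
    intro b
    apply ex_inj hB
    intro t
    rw [← hD, ← hE, T.apply_symm_apply]
  have hED : ∀ b, E (D b) = b := by
    intro b
    apply ex_inj hA
    intro t
    rw [← hE, ← hD, T.symm_apply_apply]
  have hadd : ∀ a b, D (a + b) = D a + D b := by
    intro a b
    apply ex_inj hB
    intro t
    rw [← hD, smul_add, smul_add, ex_add hA, ex_add hB, ← hD, ← hD, map_mul]
  refine ⟨{ toFun := D, invFun := E, left_inv := hED, right_inv := hDE, map_add' := hadd }, ?_, ?_, ?_⟩
  · intro a
    have := hD a 1
    simpa using this
  · intro t a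
    apply ex_inj hB
    intro s
    change ex ((s : ℂ) • D ((t : ℂ) • a)) = ex ((s : ℂ) • ((t : ℂ) • D a))
    rw [← hD, smul_smul, smul_smul]
    have := hD a (s * t)
    push_cast at this
    exact this
  · intro a
    change R (D a) = R a
    refine tendsto_nhds_unique (R_tendsto (D a)) ?_
    convert R_tendsto a using 3 with n
    rw [← hD, hT]

theorem ex_real_bound (t : ℝ) (ht : 0 < t) : R ((ex (((-t : ℝ) : ℂ) • (1 : A)) : A) - 1) ≤ 1 - Real.exp (-t) := by
  apply R_le
  intro φ
  rw [map_sub, map_one, char_ex, map_smul, map_one, smul_eq_mul, mul_one, ← Complex.ofReal_exp,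
    ← Complex.ofReal_one, ← Complex.ofReal_sub, Complex.norm_real, Real.norm_eq_abs, abs_sub_comm,
    abs_of_nonneg]
  have := Real.exp_le_one_iff.2 (neg_nonpos.2 ht.le)
  linarith

theorem z_mem (z : ℂ) (h : ∀ t : ℝ, 0 < t → ‖Complex.exp (((-t : ℝ) : ℂ) * z) - 1‖ ≤ 1 - Real.exp (-t)) :
    z.im = 0 ∧ 0 ≤ z.re ∧ z.re ≤ 1 := by
  have him : z.im = 0 := by
    by_contra hne
    set t : ℝ := Real.pi / |z.im| with ht
    have ht0 : 0 < t := div_pos Real.pi_pos (abs_pos.2 hne)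
    have h1 := h t ht0
    have hcos : Real.cos ((((-t : ℝ) : ℂ) * z).im) = -1 := by
      have : (((-t : ℝ) : ℂ) * z).im = -(t * z.im) := by simp
      rw [this, Real.cos_neg, ht]
      rcases lt_or_gt_of_ne hne with h | h
      · rw [abs_of_neg h]
        have : Real.pi / -z.im * z.im = -Real.pi := by field_simp
        rw [this, Real.cos_neg, Real.cos_pi]
      · rw [abs_of_pos h]
        have : Real.pi / z.im * z.im = Real.pi := by field_simp
        rw [this, Real.cos_pi]
    have h2 := Complex.abs_re_le_norm (Complex.exp (((-t : ℝ) : ℂ) * z) - 1)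
    rw [Complex.sub_re, Complex.exp_re, hcos, Complex.one_re] at h2
    have h3 := neg_abs_le (Real.exp (((-t : ℝ) : ℂ) * z).re * (-1) - 1)
    have h4 := Real.exp_pos (((-t : ℝ) : ℂ) * z).re
    have h5 := Real.exp_pos (-t)
    linarith
  have key : ∀ t : ℝ, 0 < t → |Real.exp (-t * z.re) - 1| ≤ 1 - Real.exp (-t) := by
    intro t ht
    have h1 := h t ht
    have e : (((-t : ℝ) : ℂ) * z) = ((-t * z.re : ℝ) : ℂ) := by
      apply Complex.ext <;> simp [him]
    rw [e, ← Complex.ofReal_exp, ← Complex.ofReal_one, ← Complex.ofReal_sub, Complex.norm_real,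
      Real.norm_eq_abs] at h1
    exact h1
  refine ⟨him, ?_, ?_⟩
  · by_contra hlt
    push Not at hlt
    set t : ℝ := 1 / -z.re with ht
    have ht0 : 0 < t := by apply div_pos one_pos; linarith
    have h1 := key t ht0
    have h2 : -t * z.re = 1 := by rw [ht]; have := hlt.ne; field_simp
    rw [h2] at h1
    have h3 := le_abs_self (Real.exp 1 - 1)
    have h4 := Real.add_one_lt_exp (one_ne_zero)
    have h5 := Real.exp_pos (-t)
    linarith
  · have h1 := key 1 one_pos
    have h2 := neg_abs_le (Real.exp (-1 * z.re) - 1)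
    have : Real.exp (-1) ≤ Real.exp (-1 * z.re) := by linarith
    rw [Real.exp_le_exp] at this
    linarith

theorem D_one_mem (T : Aˣ ≃* Bˣ)
    (hT : ∀ f : Aˣ, R ((T f : B) - 1) = R ((f : A) - 1)) (D : A ≃+ B)
    (hD : ∀ a, T (ex a) = ex (D a)) (hDs : ∀ (t : ℝ) (a : A), D ((t : ℂ) • a) = (t : ℂ) • D a)
    (φ : characterSpace ℂ B) : (φ (D 1)).im = 0 ∧ 0 ≤ (φ (D 1)).re ∧ (φ (D 1)).re ≤ 1 := by
  apply z_mem
  intro t ht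
  refine le_trans ?_ (ex_real_bound (A := A) t ht)
  rw [← hT, hD, hDs]
  have := le_R φ ((ex (((-t : ℝ) : ℂ) • D 1) : B) - 1)
  rw [map_sub, map_one φ, char_ex, map_smul, smul_eq_mul] at this
  exact this

theorem D_one (hB : ∀ b : B, spectralRadius ℂ b = 0 → b = 0) (T : Aˣ ≃* Bˣ)
    (hT : ∀ f : Aˣ, R ((T f : B) - 1) = R ((f : A) - 1)) (D : A ≃+ B)
    (hD : ∀ a, T (ex a) = ex (D a)) (hDs : ∀ (t : ℝ) (a : A), D ((t : ℂ) • a) = (t : ℂ) • D a)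
    (hDR : ∀ a, R (D a) = R a) : D 1 = 1 := by
  have hT2 : ∀ f : Bˣ, R ((T.symm f : A) - 1) = R ((f : B) - 1) := by
    intro f
    have := hT (T.symm f)
    rw [T.apply_symm_apply] at this
    exact this.symm
  have hE := D_one_mem T.symm hT2 D.symm (fun b => by
    rw [MulEquiv.symm_apply_eq, hD, D.apply_symm_apply]) (fun t b => by
    rw [AddEquiv.symm_apply_eq, hDs, D.apply_symm_apply])
  set x := D.symm 1 with hx
  have h1 : R ((x + x) - 1) ≤ 1 := by
    apply R_le
    intro ψ
    obtain ⟨h1, h2, h3⟩ := hE ψ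
    have : ψ (x + x - 1) = ((2 * (ψ x).re - 1 : ℝ) : ℂ) := by
      rw [map_sub, map_add, map_one]
      apply Complex.ext <;> simp [h1]
      ring
    rw [this, Complex.norm_real, Real.norm_eq_abs, abs_le]
    constructor <;> linarith
  rw [← hDR, map_sub, map_add, hx, D.apply_symm_apply] at h1
  apply eq_of_char hB
  intro φ
  obtain ⟨g1, g2, g3⟩ := D_one_mem T hT D hD hDs φ
  have h2 := ((Complex.abs_re_le_norm _).trans (le_R φ _)).trans h1
  rw [map_sub, map_add, map_one φ] at h2
  rw [map_one φ]
  rw [abs_le] at h2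
  simp at h2
  apply Complex.ext
  · simp; linarith
  · simp [g1]

end dmap

section lemmaZ

variable {V : Type*} [AddCommGroup V] {ι : Type*} (Q : ι → Set (V → ℝ))

/-- support-type functions -/
def Good (k : V → ℝ) : Prop := ∀ i v, ∃ ρ ∈ Q i, ρ ≤ k ∧ ρ v = k v

variable {Q}

theorem add_zero_of {ρ : V → ℝ} (h : ∀ v w, ρ (v + w) = ρ v + ρ w) : ρ 0 = 0 := by
  have := h 0 0
  rw [add_zero] at this; linarith

theorem add_neg_of {ρ : V → ℝ} (h : ∀ v w, ρ (v + w) = ρ v + ρ w) (v : V) : ρ (-v) = - ρ v := by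
  have := h v (-v)
  rw [add_neg_cancel, add_zero_of h] at this; linarith

theorem add_nsmul_of {ρ : V → ℝ} (h : ∀ v w, ρ (v + w) = ρ v + ρ w) (n : ℕ) (v : V) :
    ρ (n • v) = n * ρ v := by
  induction n with
  | zero => simp [add_zero_of h]
  | succ n ih => rw [succ_nsmul, h, ih]; push_cast; ring

theorem Good.step [Nonempty ι] (hQc : ∀ i, IsCompact (Q i))
    (hQa : ∀ i, ∀ ρ ∈ Q i, ∀ v w, ρ (v + w) = ρ v + ρ w) {k : V → ℝ} (hk : Good Q k) (x : V) :
    ∃ k' : V → ℝ, Good Q k' ∧ k' ≤ k ∧ k' (-x) ≤ - k x := by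
  obtain ⟨i0⟩ := (inferInstance : Nonempty ι)
  have hsub : ∀ v w, k (v + w) ≤ k v + k w := by
    intro v w
    obtain ⟨ρ, hρ, h1, h2⟩ := hk i0 (v + w)
    rw [← h2, hQa i0 ρ hρ]
    exact add_le_add (h1 v) (h1 w)
  have hn : ∀ (n : ℕ), n * k x ≤ k (n • x) := by
    intro n
    obtain ⟨ρ, hρ, h1, h2⟩ := hk i0 x
    rw [← h2, ← add_nsmul_of (hQa i0 ρ hρ)]
    exact h1 _
  have hlow : ∀ v (n : ℕ), - k (-v) ≤ k (n • x + v) - n * k x := by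
    intro v n
    have h1 := hsub (n • x + v) (-v)
    rw [add_neg_cancel_right] at h1
    linarith [hn n]
  have hbdd : ∀ v, BddBelow (Set.range fun n : ℕ => k (n • x + v) - n * k x) := by
    intro v
    refine ⟨- k (-v), ?_⟩
    rintro _ ⟨n, rfl⟩
    exact hlow v n
  have hk0 : k 0 = 0 := by
    obtain ⟨ρ, hρ, h1, h2⟩ := hk i0 0
    rw [← h2, add_zero_of (hQa i0 ρ hρ)]
  refine ⟨fun v => ⨅ n : ℕ, (k (n • x + v) - n * k x), ?_, ?_, ?_⟩
  · intro i v
    set κ : ℝ := ⨅ n : ℕ, (k (n • x + v) - n * k x) with hκ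
    have hκle : ∀ n : ℕ, κ ≤ k (n • x + v) - n * k x := fun n => ciInf_le (hbdd v) n
    set C : ℝ := |k v + k (-v)| with hC
    let K : ℕ → Set (V → ℝ) := fun n =>
      Q i ∩ ({ρ | ρ ≤ k} ∩ ({ρ | k x - C / (n + 1) ≤ ρ x} ∩ {ρ | κ ≤ ρ v}))
    have hKc : ∀ n : ℕ, IsClosed ({ρ : V → ℝ | ρ ≤ k} ∩ ({ρ | k x - C / (n + 1 : ℝ) ≤ ρ x} ∩ {ρ | κ ≤ ρ v})) := by
      intro n
      refine IsClosed.inter (isClosed_le continuous_id continuous_const) (IsClosed.inter ?_ ?_)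
      · exact isClosed_le continuous_const (continuous_apply x)
      · exact isClosed_le continuous_const (continuous_apply v)
    have hne : (⋂ n, K n).Nonempty := by
      apply IsCompact.nonempty_iInter_of_sequence_nonempty_isCompact_isClosed K
      · rintro n ρ ⟨h1, h2, h3, h4⟩
        refine ⟨h1, h2, ?_, h4⟩
        have h3' : k x - C / ((n + 1 : ℕ) + 1 : ℝ) ≤ ρ x := h3
        change k x - C / (n + 1 : ℝ) ≤ ρ x
        refine le_trans ?_ h3'
        have : C / ((n + 1 : ℕ) + 1 : ℝ) ≤ C / (n + 1 : ℝ) := by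
          apply div_le_div_of_nonneg_left (abs_nonneg _) (by positivity)
          push_cast; linarith
        linarith
      · intro n
        obtain ⟨ρ, hρ, h1, h2⟩ := hk i ((n + 1) • x + v)
        have ha := hQa i ρ hρ
        rw [ha, add_nsmul_of ha] at h2
        have hx := h1 x
        have hv := h1 v
        refine ⟨ρ, hρ, h1, ?_, ?_⟩
        · change k x - C / (n + 1 : ℝ) ≤ ρ x
          have h3 := hlow v (n + 1)
          have h4 : k v + k (-v) ≤ C := le_abs_self _
          rw [← h2] at h3
          push_cast at h3
          rw [sub_le_iff_le_add, ← sub_le_iff_le_add', le_div_iff₀ (by positivity)]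
          nlinarith
        · change κ ≤ ρ v
          have h3 := hκle (n + 1)
          rw [← h2] at h3
          have : ((n + 1 : ℕ) : ℝ) * ρ x ≤ ((n + 1 : ℕ) : ℝ) * k x := by gcongr
          linarith
      · exact (hQc i).inter_right (hKc 0)
      · intro n
        exact (hQc i).isClosed.inter (hKc n)
    obtain ⟨ρ, hρ⟩ := hne
    rw [Set.mem_iInter] at hρ
    have hρQ : ρ ∈ Q i := (hρ 0).1
    have hρk : ρ ≤ k := (hρ 0).2.1
    have hρv : κ ≤ ρ v := (hρ 0).2.2.2
    have ha := hQa i ρ hρQ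
    have hρx : k x ≤ ρ x := by
      have h1 : Tendsto (fun n : ℕ => k x - C / (n + 1 : ℝ)) atTop (𝓝 (k x - 0)) := by
        apply Tendsto.sub tendsto_const_nhds
        have := (tendsto_one_div_add_atTop_nhds_zero_nat (𝕜 := ℝ)).const_mul C
        simpa [div_eq_mul_inv] using this
      rw [sub_zero] at h1
      exact le_of_tendsto' h1 fun n => (hρ n).2.2.1
    have hρk' : ∀ w, ρ w ≤ ⨅ n : ℕ, (k (n • x + w) - n * k x) := by
      intro w
      apply le_ciInf
      intro n
      have h1 := hρk (n • x + w)
      rw [ha, add_nsmul_of ha] at h1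
      have : (n : ℝ) * k x ≤ n * ρ x := by gcongr
      linarith
    exact ⟨ρ, hρQ, hρk', le_antisymm (hρk' v) hρv⟩
  · intro v
    refine (ciInf_le (hbdd v) 0).trans ?_
    simp
  · refine (ciInf_le (hbdd (-x)) 1).trans ?_
    simp [hk0]

theorem Good.chain [Nonempty ι] (hQc : ∀ i, IsCompact (Q i))
    (hQa : ∀ i, ∀ ρ ∈ Q i, ∀ v w, ρ (v + w) = ρ v + ρ w) {h : V → ℝ}
    (hh : ∀ i, ∀ ρ ∈ Q i, ρ ≤ h) (c : Set (V → ℝ)) (hc : ∀ k ∈ c, Good Q k)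
    (hchain : IsChain (· ≤ ·) c) (hne : c.Nonempty) : ∃ k0, Good Q k0 ∧ ∀ k ∈ c, k0 ≤ k := by
  obtain ⟨i0⟩ := (inferInstance : Nonempty ι)
  have hnec : Nonempty c := hne.to_subtype
  have hbdd : ∀ v, BddBelow (Set.range fun k : c => (k : V → ℝ) v) := by
    intro v
    refine ⟨- h (-v), ?_⟩
    rintro _ ⟨⟨k, hk⟩, rfl⟩
    obtain ⟨ρ, hρ, h1, h2⟩ := hc k hk i0 v
    have h3 := hh i0 ρ hρ (-v)
    rw [add_neg_of (hQa i0 ρ hρ)] at h3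
    have := h1 v
    change - h (-v) ≤ k v
    linarith
  refine ⟨fun v => ⨅ k : c, (k : V → ℝ) v, ?_, ?_⟩
  · intro i v
    set κ : ℝ := ⨅ k : c, (k : V → ℝ) v with hκ
    let K : c → Set (V → ℝ) := fun k => Q i ∩ ({ρ | ρ ≤ (k : V → ℝ)} ∩ {ρ | κ ≤ ρ v})
    have hKc : ∀ k : c, IsClosed ({ρ : V → ℝ | ρ ≤ (k : V → ℝ)} ∩ {ρ | κ ≤ ρ v}) := by
      intro n
      refine IsClosed.inter (isClosed_le continuous_id continuous_const) ?_
      exact isClosed_le continuous_const (continuous_apply v)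
    have hne : (⋂ n, K n).Nonempty := by
      apply IsCompact.nonempty_iInter_of_directed_nonempty_isCompact_isClosed K
      · rintro ⟨k1, hk1⟩ ⟨k2, hk2⟩
        rcases hchain.total hk1 hk2 with h | h
        · exact ⟨⟨k1, hk1⟩, le_rfl, fun ρ hρ => ⟨hρ.1, le_trans hρ.2.1 h, hρ.2.2⟩⟩
        · exact ⟨⟨k2, hk2⟩, fun ρ hρ => ⟨hρ.1, le_trans hρ.2.1 h, hρ.2.2⟩, le_rfl⟩
      · rintro ⟨k, hk⟩
        obtain ⟨ρ, hρ, h1, h2⟩ := hc k hk i v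
        refine ⟨ρ, hρ, h1, ?_⟩
        change κ ≤ ρ v
        rw [h2]
        exact ciInf_le (hbdd v) ⟨k, hk⟩
      · intro k
        exact (hQc i).inter_right (hKc k)
      · intro k
        exact (hQc i).isClosed.inter (hKc k)
    obtain ⟨ρ, hρ⟩ := hne
    rw [Set.mem_iInter] at hρ
    have hle : ∀ w, ρ w ≤ ⨅ k : c, (k : V → ℝ) w := by
      intro w
      apply le_ciInf
      intro k
      exact (hρ k).2.1 w
    obtain ⟨k1⟩ := hnec
    exact ⟨ρ, (hρ k1).1, hle, le_antisymm (hle v) (hρ k1).2.2⟩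
  · intro k hk v
    exact ciInf_le (hbdd v) ⟨k, hk⟩

theorem lemmaZ [Nonempty ι] (hQc : ∀ i, IsCompact (Q i))
    (hQa : ∀ i, ∀ ρ ∈ Q i, ∀ v w, ρ (v + w) = ρ v + ρ w) {h : V → ℝ}
    (hh : ∀ i, ∀ ρ ∈ Q i, ρ ≤ h) (hatt : ∀ i v, ∃ ρ ∈ Q i, ρ v = h v) (x0 : V) :
    ∃ ρ : V → ℝ, (∀ i, ρ ∈ Q i) ∧ ρ x0 = h x0 := by
  have hg : Good Q h := by
    intro i v
    obtain ⟨ρ, h1, h2⟩ := hatt i v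
    exact ⟨ρ, h1, hh i ρ h1, h2⟩
  obtain ⟨h', hg', hle', hx'⟩ := hg.step hQc hQa x0
  let S : Set (V → ℝ)ᵒᵈ := {k | Good Q (OrderDual.ofDual k)}
  obtain ⟨k, hk1, hk2⟩ := zorn_le_nonempty₀ S (by
    intro c hcS hchain y hy
    obtain ⟨k0, h1, h2⟩ := Good.chain hQc hQa hh (OrderDual.toDual ⁻¹' c) (fun k hk => hcS hk)
      hchain.symm ⟨_, hy⟩
    exact ⟨OrderDual.toDual k0, h1, fun z hz => h2 _ hz⟩) (OrderDual.toDual h') hg'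
  set k1 : V → ℝ := OrderDual.ofDual k with hk1d
  have hkg : Good Q k1 := hk2.1
  have hkh : k1 ≤ h' := hk1
  have hodd : ∀ x, k1 (-x) ≤ - k1 x := by
    intro x
    obtain ⟨k', g1, g2, g3⟩ := hkg.step hQc hQa x
    have h3 : k1 ≤ k' := hk2.2 (y := OrderDual.toDual k') g1 g2
    exact (h3 _).trans g3
  have hmem : ∀ i, k1 ∈ Q i := by
    intro i
    obtain ⟨ρ, hρ, h1, h2⟩ := hkg i 0
    have : ρ = k1 := by
      apply le_antisymm h1
      intro v
      have h3 := h1 (-v)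
      rw [add_neg_of (hQa i ρ hρ)] at h3
      have h4 := hodd (-v)
      rw [neg_neg] at h4
      linarith
    rwa [← this]
  refine ⟨k1, hmem, ?_⟩
  obtain ⟨i0⟩ := (inferInstance : Nonempty ι)
  apply le_antisymm (hh i0 _ (hmem i0) x0)
  have h3 := (hkh (-x0)).trans hx'
  rw [add_neg_of (hQa i0 _ (hmem i0))] at h3
  linarith

end lemmaZ

section ringiso

variable {A : Type*} [NormedCommRing A] [NormedAlgebra ℂ A] [CompleteSpace A] [Nontrivial A]
variable {B : Type*} [NormedCommRing B] [NormedAlgebra ℂ B] [CompleteSpace B] [Nontrivial B]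

/-- rotated real parts of characters, precomposed with an additive map -/
def QQ {V : Type*} [AddCommGroup V] (L : V →+ A) : Set (V → ℝ) :=
  Set.range fun p : Metric.sphere (0 : ℂ) 1 × characterSpace ℂ A => fun v => ((p.1 : ℂ) * p.2 (L v)).re

theorem QQ_compact {V : Type*} [AddCommGroup V] (L : V →+ A) : IsCompact (QQ L) := by
  apply isCompact_range
  apply continuous_pi
  intro v
  apply Complex.continuous_re.comp
  apply Continuous.mul
  · fun_prop
  · have h1 : Continuous fun φ : characterSpace ℂ A => φ (L v) :=
      (WeakDual.eval_continuous (L v)).comp continuous_subtype_val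
    exact h1.comp continuous_snd

theorem QQ_add {V : Type*} [AddCommGroup V] (L : V →+ A) : ∀ ρ ∈ QQ L, ∀ v w, ρ (v + w) = ρ v + ρ w := by
  rintro _ ⟨p, rfl⟩ v w
  simp [mul_add]

theorem QQ_le {V : Type*} [AddCommGroup V] (L : V →+ A) : ∀ ρ ∈ QQ L, ∀ v, ρ v ≤ R (L v) := by
  rintro _ ⟨p, rfl⟩ v
  refine (Complex.re_le_norm _).trans ?_
  rw [norm_mul]
  have : ‖(p.1 : ℂ)‖ = 1 := by simp
  rw [this, one_mul]
  exact le_R _ _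

theorem exists_rot (z : ℂ) : ∃ c : Metric.sphere (0 : ℂ) 1, ((c : ℂ) * z).re = ‖z‖ := by
  by_cases hz : z = 0
  · exact ⟨⟨1, by simp⟩, by simp [hz]⟩
  · have hn : ‖z‖ ≠ 0 := norm_ne_zero_iff.2 hz
    refine ⟨⟨(starRingEnd ℂ) z / ‖z‖, by simp [hn]⟩, ?_⟩
    have : (starRingEnd ℂ) z / ‖z‖ * z = ((‖z‖ : ℝ) : ℂ) := by
      rw [div_mul_eq_mul_div, Complex.conj_mul']
      have : (‖z‖ : ℂ) ≠ 0 := by exact_mod_cast hn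
      field_simp
    change ((starRingEnd ℂ) z / ‖z‖ * z).re = ‖z‖
    rw [this, Complex.ofReal_re]

theorem QQ_att {V : Type*} [AddCommGroup V] (L : V →+ A) : ∀ v, ∃ ρ ∈ QQ L, ρ v = R (L v) := by
  intro v
  obtain ⟨φ, hφ⟩ := exR (L v)
  obtain ⟨c, hc⟩ := exists_rot (φ (L v))
  exact ⟨_, ⟨(c, φ), rfl⟩, by rw [← hφ]; exact hc⟩

theorem good_char (D : A ≃+ B) (hDR : ∀ a, R (D a) = R a) (b0 : B) :
    ∃ φ : characterSpace ℂ B, R b0 ≤ ‖φ b0‖ ∧ ∀ c : ℂ, ‖c‖ = 1 → ∃ d : ℂ, ‖d‖ = 1 ∧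
      ∃ ψ : characterSpace ℂ A, ∀ x, (c * φ (D x)).re = (d * ψ x).re := by
  let L : Metric.sphere (0 : ℂ) 1 → (B →+ A) := fun c =>
    { toFun := fun b => D.symm ((c : ℂ) • b)
      map_zero' := by simp
      map_add' := by intro x y; simp }
  let Q : Option (Metric.sphere (0 : ℂ) 1) → Set (B → ℝ) := fun i =>
    match i with
    | none => QQ (AddMonoidHom.id B)
    | some c => QQ (L c)
  have hRL : ∀ c v, R (L c v) = R v := by
    intro c v
    change R (D.symm ((c : ℂ) • v)) = R v
    rw [← hDR, D.apply_symm_apply, R_smul]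
    have : ‖(c : ℂ)‖ = 1 := by simp
    rw [this, one_mul]
  obtain ⟨ρ, h1, h2⟩ := lemmaZ (Q := Q) (h := fun b => R b)
    (by rintro (_ | c); exacts [QQ_compact _, QQ_compact _])
    (by rintro (_ | c); exacts [QQ_add _, QQ_add _])
    (by
      rintro (_ | c)
      · exact fun ρ hρ v => QQ_le _ ρ hρ v
      · exact fun ρ hρ v => (QQ_le _ ρ hρ v).trans (hRL c v).le)
    (by
      rintro (_ | c) v
      · exact QQ_att (AddMonoidHom.id B) v
      · obtain ⟨ρ, g1, g2⟩ := QQ_att (L c) v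
        exact ⟨ρ, g1, g2.trans (hRL c v)⟩) b0
  obtain ⟨⟨c0, φ⟩, hφ⟩ := h1 none
  have hφ' : ∀ b, ρ b = ((c0 : ℂ) * φ b).re := fun b => by rw [← hφ]; rfl
  have hc0 : ‖(c0 : ℂ)‖ = 1 := by simp
  refine ⟨φ, ?_, ?_⟩
  · rw [← h2, hφ']
    refine (Complex.re_le_norm _).trans ?_
    rw [norm_mul, hc0, one_mul]
  · intro c hc
    have hcne : c ≠ 0 := by intro h; rw [h] at hc; simp at hc
    have hc0ne : (c0 : ℂ) ≠ 0 := by intro h; rw [h] at hc0; simp at hc0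
    obtain ⟨⟨d, ψ⟩, hψ⟩ := h1 (some ⟨(c0 : ℂ) * c⁻¹, by simp [hc0, hc]⟩)
    refine ⟨d, by simp, ψ, fun x => ?_⟩
    have h3 := congrFun hψ ((c * (c0 : ℂ)⁻¹) • D x)
    rw [hφ'] at h3
    have h4 : ((d : ℂ) * ψ (D.symm (((c0 : ℂ) * c⁻¹) • ((c * (c0 : ℂ)⁻¹) • D x)))).re =
      ((c0 : ℂ) * φ ((c * (c0 : ℂ)⁻¹) • D x)).re := h3
    have h5 : (c0 : ℂ) * c⁻¹ * (c * (c0 : ℂ)⁻¹) = 1 := by field_simp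
    rw [smul_smul, h5, one_smul, D.symm_apply_apply, map_smul, smul_eq_mul, ← mul_assoc] at h4
    have h6 : (c0 : ℂ) * (c * (c0 : ℂ)⁻¹) = c := by field_simp
    rw [h6] at h4
    exact h4.symm

theorem eq_of_re (α β γ : ℂ) (ψ ψ' χ : characterSpace ℂ A)
    (h : ∀ x, (α * ψ x + β * ψ' x).re = (γ * χ x).re) (x : A) :
    α * ψ x + β * ψ' x = γ * χ x := by
  apply Complex.ext (h x)
  have := h (Complex.I • x)
  simp only [map_smul, smul_eq_mul] at this
  have e1 : α * (Complex.I * ψ x) + β * (Complex.I * ψ' x) = Complex.I * (α * ψ x + β * ψ' x) := by ring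
  have e2 : γ * (Complex.I * χ x) = Complex.I * (γ * χ x) := by ring
  rw [e1, e2, Complex.I_mul_re, Complex.I_mul_re] at this
  linarith

theorem mult_of_good (θ : A → ℂ) (h1 : θ 1 = 1)
    (h : ∀ c : ℂ, ‖c‖ = 1 → ∃ d : ℂ, ‖d‖ = 1 ∧
      ∃ ψ : characterSpace ℂ A, ∀ x, (c * θ x).re = (d * ψ x).re) :
    ∃ ψ : characterSpace ℂ A, (∀ x, θ x = ψ x) ∨ (∀ x, θ x = (starRingEnd ℂ) (ψ x)) := by
  have hsq : ∀ d : ℂ, ‖d‖ = 1 → d.re ^ 2 + d.im ^ 2 = 1 := by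
    intro d hd
    have := Complex.sq_norm d
    rw [hd, Complex.normSq_apply] at this
    nlinarith
  obtain ⟨d1, hd1, ψ, hψ⟩ := h 1 (by simp)
  obtain ⟨d2, hd2, ψ', hψ'⟩ := h (-Complex.I) (by simp)
  obtain ⟨d3, hd3, χ, hχ⟩ := h (3 / 5 + 4 / 5 * Complex.I) (by
    rw [Complex.norm_eq_sqrt_sq_add_sq]
    norm_num)
  have a1 := hψ 1
  have a2 := hψ' 1
  have a3 := hχ 1
  simp [h1] at a1 a2 a3
  have s1 := hsq d1 hd1
  have s2 := hsq d2 hd2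
  have s3 := hsq d3 hd3
  rw [← a1] at s1
  rw [← a2] at s2
  rw [← a3] at s3
  have b1 : d1.im = 0 := by nlinarith
  have hre : ∀ x, (θ x).re = (ψ x).re := by
    intro x
    have := hψ x
    simp [← a1, b1] at this
    exact this
  obtain ⟨σ, hσ, hσ2⟩ : ∃ σ : ℝ, σ ^ 2 = 1 ∧ d2.im = -σ := ⟨-d2.im, by nlinarith, by ring⟩
  obtain ⟨τ, hτ, hτ2⟩ : ∃ τ : ℝ, τ ^ 2 = 1 ∧ d3.im = 4 / 5 * τ := ⟨5 / 4 * d3.im, by nlinarith, by ring⟩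
  have him : ∀ x, (θ x).im = σ * (ψ' x).im := by
    intro x
    have := hψ' x
    simp [← a2, hσ2] at this
    linarith
  have hlin : ∀ x, 3 * ψ x + (4 * Complex.I * σ) * ψ' x = (3 + 4 * Complex.I * τ) * χ x := by
    apply eq_of_re
    intro x
    have := hχ x
    simp [← a3, hτ2, hre, him] at this
    simp
    linarith
  have hστ : (σ : ℂ) = τ := by
    have := hlin 1
    simp at this
    exact_mod_cast this
  have hσc : (σ : ℂ) ^ 2 = 1 := by exact_mod_cast hσ
  have hσ0 : (σ : ℂ) ≠ 0 := by intro h; rw [h] at hσc; simp at hσc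
  have heq : ∀ x, ψ x = ψ' x := by
    intro x
    have l1 := hlin x
    have l2 := hlin (x * x)
    rw [← hστ] at l1 l2
    simp only [map_mul] at l2
    have : (24 * Complex.I * σ) * (ψ x - ψ' x) ^ 2 = 0 := by
      have hI := Complex.I_sq
      linear_combination (2 * (3 + 4 * Complex.I * σ)) * l2 - 2 * (3 * ψ x + (4 * Complex.I * σ) * ψ' x + (3 + 4 * Complex.I * σ) * χ x) * l1
    have h2 : (24 * Complex.I * (σ : ℂ)) ≠ 0 := by simp [hσ0]
    have h3 := (mul_eq_zero.1 this).resolve_left h2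
    exact sub_eq_zero.1 (pow_eq_zero_iff two_ne_zero |>.1 h3)
  refine ⟨ψ, ?_⟩
  rcases sq_eq_sq_iff_eq_or_eq_neg.1 (hσ.trans (one_pow 2).symm) with h | h
  · left
    intro x
    apply Complex.ext (hre x)
    rw [him, h, heq, one_mul]
  · right
    intro x
    apply Complex.ext
    · rw [hre, Complex.conj_re]
    · rw [him, h, heq, Complex.conj_im]; ring

/-- the special characters suffice -/
theorem exists_special (D : A ≃+ B) (hDR : ∀ a, R (D a) = R a) (hD1 : D 1 = 1) (b0 : B) :
    ∃ φ : characterSpace ℂ B, R b0 ≤ ‖φ b0‖ ∧ ∃ ψ : characterSpace ℂ A,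
      (∀ x, φ (D x) = ψ x) ∨ (∀ x, φ (D x) = (starRingEnd ℂ) (ψ x)) := by
  obtain ⟨φ, h1, h2⟩ := good_char D hDR b0
  exact ⟨φ, h1, mult_of_good (fun x => φ (D x)) (by rw [hD1, map_one φ]) h2⟩

theorem eq_of_special (hB : ∀ b : B, spectralRadius ℂ b = 0 → b = 0)
    (D : A ≃+ B) (hDR : ∀ a, R (D a) = R a) (hD1 : D 1 = 1) {b c : B}
    (h : ∀ (φ : characterSpace ℂ B) (ψ : characterSpace ℂ A),
      ((∀ x, φ (D x) = ψ x) ∨ (∀ x, φ (D x) = (starRingEnd ℂ) (ψ x))) → φ b = φ c) : b = c := by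
  rw [← sub_eq_zero]
  apply hB
  obtain ⟨φ, h1, ψ, h2⟩ := exists_special D hDR hD1 (b - c)
  rw [map_sub, h φ ψ h2, sub_self, norm_zero] at h1
  rw [sr_R, le_antisymm h1 (R_nonneg _)]
  simp

theorem D_mul (hB : ∀ b : B, spectralRadius ℂ b = 0 → b = 0)
    (D : A ≃+ B) (hDR : ∀ a, R (D a) = R a) (hD1 : D 1 = 1) (x y : A) : D (x * y) = D x * D y := by
  apply eq_of_special hB D hDR hD1
  rintro φ ψ (h | h)
  · rw [map_mul φ, h, h, h, map_mul]
  · rw [map_mul φ, h, h, h, map_mul, map_mul]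

theorem D_ex (hB : ∀ b : B, spectralRadius ℂ b = 0 → b = 0)
    (D : A ≃+ B) (hDR : ∀ a, R (D a) = R a) (hD1 : D 1 = 1) (x : A) : D (ex x : A) = (ex (D x) : B) := by
  apply eq_of_special hB D hDR hD1
  rintro φ ψ (h | h)
  · rw [char_ex, h, h, char_ex]
  · rw [char_ex, h, h, char_ex, Complex.exp_conj]

end ringiso

section rigidity

variable {A : Type*} [NormedCommRing A] [NormedAlgebra ℂ A] [CompleteSpace A] [Nontrivial A]

theorem char_ex_shift (φ : characterSpace ℂ A) (y : A) {v : ℂ} (hv : v ≠ 0) :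
    φ (ex (y + algebraMap ℂ A (Complex.log v)) : A) = φ (ex y : A) * v := by
  rw [char_ex, char_ex, map_add, char_algMap, Complex.exp_add, Complex.exp_log hv]

theorem eq_neg_one_of {z : ℂ} (h1 : ‖z‖ ≤ 1) (h2 : 2 ≤ ‖z - 1‖) : z = -1 := by
  have a1 := Complex.sq_norm z
  have a2 := Complex.sq_norm (z - 1)
  rw [Complex.normSq_apply] at a1 a2
  simp at a2
  have b1 : ‖z‖ ^ 2 ≤ 1 := by nlinarith [norm_nonneg z]
  have b2 : 4 ≤ ‖z - 1‖ ^ 2 := by nlinarith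
  have hre : z.re = -1 := by nlinarith [sq_nonneg (z.re + 1), sq_nonneg z.im]
  have him : z.im = 0 := by nlinarith [sq_nonneg z.im]
  apply Complex.ext <;> simp [hre, him]

theorem eq_one_of {z : ℂ} (h1 : ‖z‖ ≤ 1) (h2 : 1 ≤ z.re) : z = 1 := by
  have a1 := Complex.sq_norm z
  rw [Complex.normSq_apply] at a1
  have b1 : ‖z‖ ^ 2 ≤ 1 := by nlinarith [norm_nonneg z]
  have hre : z.re = 1 := by nlinarith [sq_nonneg z.im]
  have him : z.im = 0 := by nlinarith [sq_nonneg z.im]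
  apply Complex.ext <;> simp [hre, him]

theorem arg1 {f g : Aˣ} (H : ∀ y : A, R ((g * ex y : Aˣ) - 1 : A) = R ((f * ex y : Aˣ) - 1 : A))
    {y : A} {ψ0 : characterSpace ℂ A}
    (hmax : ∀ ψ : characterSpace ℂ A, ‖ψ ((f * ex y : Aˣ) : A)‖ ≤ ‖ψ0 ((f * ex y : Aˣ) : A)‖) :
    ‖ψ0 ((g * ex y : Aˣ) : A)‖ ≤ ‖ψ0 ((f * ex y : Aˣ) : A)‖ := by
  set l := ψ0 ((f * ex y : Aˣ) : A) with hl
  set μ := ψ0 ((g * ex y : Aˣ) : A) with hμ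
  have hl0 : l ≠ 0 := char_unit_ne _ _
  have hμ0 : μ ≠ 0 := char_unit_ne _ _
  have nl : 0 < ‖l‖ := norm_pos_iff.2 hl0
  have nμ : 0 < ‖μ‖ := norm_pos_iff.2 hμ0
  have cl : (‖l‖ : ℂ) ≠ 0 := by exact_mod_cast nl.ne'
  have cμ : (‖μ‖ : ℂ) ≠ 0 := by exact_mod_cast nμ.ne'
  set v : ℂ := -(‖μ‖ / (μ * ‖l‖)) with hv
  have hv0 : v ≠ 0 := neg_ne_zero.2 (div_ne_zero cμ (mul_ne_zero hμ0 cl))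
  have hvn : ‖v‖ = ‖l‖⁻¹ := by
    rw [hv, norm_neg, norm_div, norm_mul, Complex.norm_real, Complex.norm_real, norm_norm, norm_norm]
    field_simp
  have h1 : R ((f * ex (y + algebraMap ℂ A (Complex.log v)) : Aˣ) - 1 : A) ≤ 2 := by
    apply R_le
    intro ψ
    have h2 := hmax ψ
    rw [Units.val_mul, map_mul] at h2
    rw [map_sub, map_one, Units.val_mul, map_mul, char_ex_shift _ _ hv0, ← mul_assoc]
    refine (norm_sub_le _ _).trans ?_
    rw [norm_mul, hvn, norm_one]
    have := mul_le_mul_of_nonneg_right h2 (inv_pos.2 nl).le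
    rw [mul_inv_cancel₀ nl.ne'] at this
    linarith
  rw [← H] at h1
  have h3 := (le_R ψ0 _).trans h1
  rw [map_sub, map_one, Units.val_mul, map_mul, char_ex_shift _ _ hv0, ← mul_assoc, ← map_mul,
    ← Units.val_mul, ← hμ] at h3
  have h4 : μ * v - 1 = ((-(‖μ‖ / ‖l‖ + 1) : ℝ) : ℂ) := by
    rw [hv]; push_cast; field_simp; ring
  rw [h4, Complex.norm_real, norm_neg, Real.norm_eq_abs, abs_of_pos (by positivity)] at h3
  have h5 : ‖μ‖ / ‖l‖ ≤ 1 := by linarith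
  rwa [div_le_one nl] at h5

theorem arg2 {f g : Aˣ} (H : ∀ y : A, R ((g * ex y : Aˣ) - 1 : A) = R ((f * ex y : Aˣ) - 1 : A))
    {y : A} {ψ0 : characterSpace ℂ A}
    (hmax : ∀ ψ : characterSpace ℂ A, ‖ψ ((f * ex y : Aˣ) : A)‖ ≤ ‖ψ0 ((f * ex y : Aˣ) : A)‖)
    (hn : ‖ψ0 ((g * ex y : Aˣ) : A)‖ = ‖ψ0 ((f * ex y : Aˣ) : A)‖) :
    ψ0 ((g * ex y : Aˣ) : A) = ψ0 ((f * ex y : Aˣ) : A) := by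
  set l := ψ0 ((f * ex y : Aˣ) : A) with hl
  set μ := ψ0 ((g * ex y : Aˣ) : A) with hμ
  have hl0 : l ≠ 0 := char_unit_ne _ _
  have hμ0 : μ ≠ 0 := char_unit_ne _ _
  have nl : 0 < ‖l‖ := norm_pos_iff.2 hl0
  set v : ℂ := -μ⁻¹ with hv
  have hv0 : v ≠ 0 := neg_ne_zero.2 (inv_ne_zero hμ0)
  set F : A := l⁻¹ • ((f * ex y : Aˣ) : A) with hF
  set y1 : A := y + (F - 1) with hy1
  have hval : ∀ (h : Aˣ) (ψ : characterSpace ℂ A),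
      ψ ((h * ex (y1 + algebraMap ℂ A (Complex.log v)) : Aˣ) : A) =
        ψ ((h * ex y : Aˣ) : A) * Complex.exp (ψ F - 1) * v := by
    intro h ψ
    rw [Units.val_mul, map_mul, char_ex_shift _ _ hv0, Units.val_mul, map_mul, hy1, char_ex, char_ex,
      map_add, map_sub, map_one, Complex.exp_add]
    ring
  have hFv : ∀ ψ : characterSpace ℂ A, ψ F = l⁻¹ * ψ ((f * ex y : Aˣ) : A) := by
    intro ψ
    rw [hF, map_smul, smul_eq_mul]
  have hF0 : ψ0 F = 1 := by rw [hFv, ← hl, inv_mul_cancel₀ hl0]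
  have hFn : ∀ ψ : characterSpace ℂ A, ‖ψ F‖ ≤ 1 := by
    intro ψ
    rw [hFv, norm_mul, norm_inv, inv_mul_le_iff₀ nl, mul_one]
    exact hmax ψ
  have h1 : 2 ≤ R ((f * ex (y1 + algebraMap ℂ A (Complex.log v)) : Aˣ) - 1 : A) := by
    rw [← H]
    refine le_trans ?_ (le_R ψ0 _)
    rw [map_sub, map_one, hval, hF0, ← hμ, hv, sub_self, Complex.exp_zero, mul_one, mul_neg,
      mul_inv_cancel₀ hμ0]
    norm_num
  obtain ⟨ψ1, hψ1⟩ := exR ((f * ex (y1 + algebraMap ℂ A (Complex.log v)) : Aˣ) - 1 : A)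
  rw [← hψ1, map_sub, map_one, hval] at h1
  have hfe : ψ1 ((f * ex y : Aˣ) : A) = l * ψ1 F := by
    rw [hFv, mul_inv_cancel_left₀ hl0]
  rw [hfe] at h1
  have hlv : ‖l‖ * ‖v‖ = 1 := by
    rw [hv, norm_neg, norm_inv, hn, mul_inv_cancel₀ nl.ne']
  have hFre : (ψ1 F).re ≤ 1 := (Complex.re_le_norm _).trans (hFn ψ1)
  have he1 : Real.exp ((ψ1 F).re - 1) ≤ 1 := Real.exp_le_one_iff.2 (by linarith)
  have hm : ‖l * ψ1 F * Complex.exp (ψ1 F - 1) * v‖ = ‖ψ1 F‖ * Real.exp ((ψ1 F).re - 1) := by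
    rw [norm_mul, norm_mul, norm_mul, Complex.norm_exp, Complex.sub_re, Complex.one_re]
    linear_combination (‖ψ1 F‖ * Real.exp ((ψ1 F).re - 1)) * hlv
  have hmle : ‖l * ψ1 F * Complex.exp (ψ1 F - 1) * v‖ ≤ 1 := by
    rw [hm]
    exact mul_le_one₀ (hFn ψ1) (Real.exp_pos _).le he1
  have hm1 := eq_neg_one_of hmle h1
  have hF1 : ψ1 F = 1 := by
    apply eq_one_of (hFn ψ1)
    rw [hm1, norm_neg, norm_one] at hm
    have : 1 ≤ Real.exp ((ψ1 F).re - 1) := by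
      nlinarith [hFn ψ1, norm_nonneg (ψ1 F), Real.exp_pos ((ψ1 F).re - 1)]
    rw [Real.one_le_exp_iff] at this
    linarith
  rw [hF1, sub_self, Complex.exp_zero, mul_one, mul_one, hv, mul_neg, neg_inj] at hm1
  rw [mul_inv_eq_one₀ hμ0] at hm1
  exact hm1.symm

theorem spread {f : Aˣ} {w : A} {c : ℂ} {s : ℝ}
    (h : ∀ (y : A) (ψ0 : characterSpace ℂ A),
      (∀ ψ : characterSpace ℂ A, ‖ψ ((f * ex y : Aˣ) : A)‖ ≤ ‖ψ0 ((f * ex y : Aˣ) : A)‖) →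
        (c * ψ0 w).re ≤ s) (ψ : characterSpace ℂ A) : (c * ψ w).re ≤ s := by
  have hfp : ∀ φ : characterSpace ℂ A, 0 < ‖φ (f : A)‖ := fun φ => norm_pos_iff.2 (char_unit_ne φ f)
  set C : ℝ := Real.log (R (f : A)) - Real.log ‖ψ (f : A)‖ with hC
  have key : ∀ N : ℕ, (c * ψ w).re ≤ s + C * (1 / ((N : ℝ) + 1)) := by
    intro N
    set y : A := (((N : ℝ) + 1 : ℝ) : ℂ) • (c • w) with hy
    have hval : ∀ φ : characterSpace ℂ A, ‖φ ((f * ex y : Aˣ) : A)‖ =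
        ‖φ (f : A)‖ * Real.exp (((N : ℝ) + 1) * (c * φ w).re) := by
      intro φ
      rw [Units.val_mul, map_mul, norm_mul, char_ex, Complex.norm_exp, hy, map_smul, map_smul,
        smul_eq_mul, smul_eq_mul, Complex.re_ofReal_mul]
    obtain ⟨ψ0, hψ0⟩ := exR ((f * ex y : Aˣ) : A)
    have hmax : ∀ φ : characterSpace ℂ A, ‖φ ((f * ex y : Aˣ) : A)‖ ≤ ‖ψ0 ((f * ex y : Aˣ) : A)‖ := by
      intro φ
      rw [hψ0]; exact le_R φ _
    have h1 := h y ψ0 hmax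
    have h2 := hmax ψ
    rw [hval, hval] at h2
    have h3 := Real.log_le_log (mul_pos (hfp ψ) (Real.exp_pos _)) h2
    rw [Real.log_mul (hfp _).ne' (Real.exp_pos _).ne', Real.log_mul (hfp _).ne' (Real.exp_pos _).ne',
      Real.log_exp, Real.log_exp] at h3
    have h4 := Real.log_le_log (hfp ψ0) (le_R ψ0 (f : A))
    have hN : (0 : ℝ) < (N : ℝ) + 1 := by positivity
    have h5 : ((N : ℝ) + 1) * (c * ψ w).re ≤ ((N : ℝ) + 1) * s + C := by
      have := mul_le_mul_of_nonneg_left h1 hN.le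
      linarith
    have h6 : s + C * (1 / ((N : ℝ) + 1)) = (((N : ℝ) + 1) * s + C) / ((N : ℝ) + 1) := by
      field_simp
    rw [h6, le_div_iff₀ hN]
    linarith
  have hlim : Tendsto (fun N : ℕ => s + C * (1 / ((N : ℝ) + 1))) atTop (𝓝 (s + C * 0)) :=
    tendsto_const_nhds.add ((tendsto_one_div_add_atTop_nhds_zero_nat (𝕜 := ℝ)).const_mul C)
  rw [mul_zero, add_zero] at hlim
  exact ge_of_tendsto' hlim key

theorem norm_w_le {f g : Aˣ}
    (H : ∀ y : A, R ((g * ex y : Aˣ) - 1 : A) = R ((f * ex y : Aˣ) - 1 : A))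
    (ψ : characterSpace ℂ A) : ‖ψ (g : A)‖ ≤ ‖ψ (f : A)‖ := by
  obtain ⟨c, hc⟩ := exists_rot (ψ ((g * f⁻¹ : Aˣ) : A))
  have hcn : ‖(c : ℂ)‖ = 1 := by simp
  have h1 := spread (f := f) (w := ((g * f⁻¹ : Aˣ) : A)) (c := (c : ℂ)) (s := 1) (by
    intro y ψ0 hmax
    have h2 := arg1 H hmax
    rw [Units.val_mul, map_mul, Units.val_mul, map_mul, norm_mul, norm_mul] at h2
    have hp : 0 < ‖ψ0 (ex y : A)‖ := norm_pos_iff.2 (char_unit_ne _ _)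
    have hp2 : 0 < ‖ψ0 (f : A)‖ := norm_pos_iff.2 (char_unit_ne _ _)
    have h3 := le_of_mul_le_mul_right h2 hp
    refine (Complex.re_le_norm _).trans ?_
    rw [norm_mul, hcn, one_mul, Units.val_mul, map_mul, char_inv, norm_mul, norm_inv,
      ← div_eq_mul_inv, div_le_one hp2]
    exact h3) ψ
  rw [hc] at h1
  have hp2 : 0 < ‖ψ (f : A)‖ := norm_pos_iff.2 (char_unit_ne _ _)
  rwa [Units.val_mul, map_mul, char_inv, norm_mul, norm_inv, ← div_eq_mul_inv, div_le_one hp2] at h1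

theorem rigid (hA : ∀ a : A, spectralRadius ℂ a = 0 → a = 0) {f g : Aˣ}
    (H : ∀ y : A, R ((g * ex y : Aˣ) - 1 : A) = R ((f * ex y : Aˣ) - 1 : A)) : g = f := by
  have hnorm : ∀ ψ : characterSpace ℂ A, ‖ψ (g : A)‖ = ‖ψ (f : A)‖ := fun ψ =>
    le_antisymm (norm_w_le H ψ) (norm_w_le (fun y => (H y).symm) ψ)
  apply unit_ext hA
  intro ψ
  have hw : ∀ c : ℂ, (c * ψ ((g * f⁻¹ : Aˣ) : A)).re ≤ c.re := by
    intro c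
    apply spread (f := f)
    intro y ψ0 hmax
    have h2 := arg2 H hmax (by
      rw [Units.val_mul, map_mul, Units.val_mul, map_mul, norm_mul, norm_mul, hnorm])
    rw [Units.val_mul, map_mul, Units.val_mul, map_mul] at h2
    have h3 := mul_right_cancel₀ (char_unit_ne ψ0 (ex y)) h2
    rw [Units.val_mul, map_mul, char_inv, h3, mul_inv_cancel₀ (char_unit_ne _ _), mul_one]
  have a1 := hw 1
  have a2 := hw (-1)
  have a3 := hw Complex.I
  have a4 := hw (-Complex.I)
  simp only [one_mul, neg_mul, Complex.neg_re, Complex.I_mul_re, Complex.one_re, Complex.I_re] at a1 a2 a3 a4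
  have h5 : ψ ((g * f⁻¹ : Aˣ) : A) = 1 := by
    apply Complex.ext
    · rw [Complex.one_re]; linarith
    · rw [Complex.one_im]; linarith
  rw [Units.val_mul, map_mul, char_inv, mul_inv_eq_one₀ (char_unit_ne _ _)] at h5
  exact h5

end rigidity

section main

theorem nontriv {A B : Type*} [NormedCommRing A] [NormedAlgebra ℂ A] [CompleteSpace A]
    [NormedCommRing B] [NormedAlgebra ℂ B] [CompleteSpace B] [Nontrivial A] [Nontrivial B]
    (hA : ∀ a : A, spectralRadius ℂ a = 0 → a = 0)
    (hB : ∀ b : B, spectralRadius ℂ b = 0 → b = 0)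
    (T : Aˣ → Bˣ) (hsurj : Function.Surjective T)
    (hmul : ∀ f g : Aˣ, T (f * g) = T f * T g)
    (h : ∀ f : Aˣ, spectralRadius ℂ ((T f : B) - 1) = spectralRadius ℂ ((f : A) - 1)) :
    ∃ S : A ≃+* B, (∀ (r : ℝ) (a : A), S (((r : ℂ)) • a) = ((r : ℂ)) • S a) ∧
        (∀ f : Aˣ, S (f : A) = ((T f : B))) ∧ ∀ a, spectralRadius ℂ (S a) = spectralRadius ℂ a := by
  have hT0 : ∀ f : Aˣ, R ((T f : B) - 1) = R ((f : A) - 1) := fun f => by rw [R, R, h]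
  let T1 : Aˣ →* Bˣ := MonoidHom.mk' T hmul
  have hinj : Function.Injective T1 := by
    rw [injective_iff_map_eq_one]
    intro f hf
    have h1 := h f
    have h2 : T f = 1 := hf
    rw [h2, Units.val_one, sub_self, spectrum.spectralRadius_zero] at h1
    exact Units.ext (sub_eq_zero.1 (hA _ h1.symm))
  let T2 : Aˣ ≃* Bˣ := MulEquiv.ofBijective T1 ⟨hinj, hsurj⟩
  have hT2 : ∀ f, T2 f = T f := fun f => rfl
  have hT : ∀ f : Aˣ, R ((T2 f : B) - 1) = R ((f : A) - 1) := hT0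
  obtain ⟨D, hD, hDs, hDR⟩ := exD hA hB T2 hT
  have hD1 := D_one hB T2 hT D hD hDs hDR
  let S : A ≃+* B := { D with map_mul' := D_mul hB D hDR hD1 }
  have hS : ∀ a, S a = D a := fun a => rfl
  refine ⟨S, hDs, ?_, ?_⟩
  · intro f
    set g : Aˣ := Units.map (S.symm : B →* A) (T f) with hg
    have hgv : S (g : A) = (T f : B) := by
      rw [hg]
      exact S.apply_symm_apply _
    have hgf : g = f := by
      apply rigid hA
      intro y
      have hSe : S (ex y : A) = (T (ex y) : B) := by
        rw [hS, D_ex hB D hDR hD1, ← hT2, hD]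
      rw [← hDR, ← hT0, hmul, ← hS, map_sub, map_one, Units.val_mul, map_mul, hgv, hSe, Units.val_mul]
    rw [← hgv, hgf]
  · intro a
    rw [sr_R, sr_R, hS, hDR]

theorem triv {C : Type*} [NormedCommRing C] [NormedAlgebra ℂ C] (hu : ∀ u : Cˣ, u = 1) :
    Subsingleton C := by
  have h2 : IsUnit (algebraMap ℂ C 2) := (IsUnit.mk0 (2 : ℂ) two_ne_zero).map _
  have h3 : algebraMap ℂ C 2 = 1 := by
    have := congrArg Units.val (hu h2.unit)
    simpa using this
  have h4 : (1 : C) + 1 = 1 := by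
    rw [← one_add_one_eq_two, map_add, map_one] at h3
    exact h3
  have h5 : (1 : C) = 0 := by simpa using h4
  exact subsingleton_of_zero_eq_one h5.symm

/-- trivial ring isomorphism -/
def trivEquiv (A B : Type*) [NormedCommRing A] [NormedCommRing B] [Subsingleton A] [Subsingleton B] :
    A ≃+* B where
  toFun := fun _ => 0
  invFun := fun _ => 0
  left_inv := fun _ => Subsingleton.elim _ _
  right_inv := fun _ => Subsingleton.elim _ _
  map_mul' := fun _ _ => Subsingleton.elim _ _
  map_add' := fun _ _ => Subsingleton.elim _ _

end main

end S17

theorem stmt17 {A B : Type*} [NormedCommRing A] [NormedAlgebra ℂ A] [CompleteSpace A]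
    [NormedCommRing B] [NormedAlgebra ℂ B] [CompleteSpace B]
    (hA : ∀ a : A, spectralRadius ℂ a = 0 → a = 0)
    (hB : ∀ b : B, spectralRadius ℂ b = 0 → b = 0)
    (T : Aˣ → Bˣ) (hsurj : Function.Surjective T)
    (hmul : ∀ f g : Aˣ, T (f * g) = T f * T g) :
    ((∀ f g : Aˣ, spectralRadius ℂ ((T f : B) - (T g : B))
        = spectralRadius ℂ ((f : A) - (g : A))) ↔
      (∀ f : Aˣ, spectralRadius ℂ ((T f : B) - 1) = spectralRadius ℂ ((f : A) - 1))) ∧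
    ((∀ f : Aˣ, spectralRadius ℂ ((T f : B) - 1) = spectralRadius ℂ ((f : A) - 1)) →
      ∃ S : A ≃+* B, (∀ (r : ℝ) (a : A), S (((r : ℂ)) • a) = ((r : ℂ)) • S a) ∧
        ∀ f : Aˣ, S (f : A) = ((T f : B))) := by
  have hT1 : T 1 = 1 := by
    have := hmul 1 1
    rw [mul_one] at this
    simpa using this
  have key : (∀ f : Aˣ, spectralRadius ℂ ((T f : B) - 1) = spectralRadius ℂ ((f : A) - 1)) →
      ∃ S : A ≃+* B, (∀ (r : ℝ) (a : A), S (((r : ℂ)) • a) = ((r : ℂ)) • S a) ∧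
        (∀ f : Aˣ, S (f : A) = ((T f : B))) ∧ ∀ a, spectralRadius ℂ (S a) = spectralRadius ℂ a := by
    intro h
    have hinj : ∀ f, T f = 1 → f = 1 := by
      intro f hf
      have h1 := h f
      rw [hf, Units.val_one, sub_self, spectrum.spectralRadius_zero] at h1
      exact Units.ext (sub_eq_zero.1 (hA _ h1.symm))
    rcases subsingleton_or_nontrivial A with hs | hn
    · have : Subsingleton B := by
        apply S17.triv
        intro u
        obtain ⟨f, rfl⟩ := hsurj u
        rw [Subsingleton.elim f 1, hT1]
      refine ⟨S17.trivEquiv A B, fun _ _ => Subsingleton.elim _ _,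
          fun _ => Subsingleton.elim _ _, fun a => ?_⟩
      rw [Subsingleton.elim a 0, map_zero, spectrum.spectralRadius_zero, spectrum.spectralRadius_zero]
    · rcases subsingleton_or_nontrivial B with hs | hn2
      · exfalso
        have : Subsingleton A := by
          apply S17.triv
          intro u
          exact hinj u (Subsingleton.elim _ _)
        exact not_subsingleton A this
      · exact S17.nontriv hA hB T hsurj hmul h
  refine ⟨⟨fun h f => ?_, fun h f g => ?_⟩, fun h => ?_⟩
  · have := h f 1
    rwa [hT1, Units.val_one, Units.val_one] at this
  · obtain ⟨S, h1, h2, h3⟩ := key h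
    rw [← h2, ← h2, ← map_sub, h3]
  · obtain ⟨S, h1, h2, h3⟩ := key h
    exact ⟨S, h1, h2⟩
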